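/- arXiv:2401.13190 — 4 statements merged into one kernel-verified Lean document; each statement's English description precedes it below -/
import Mathlib

section
/- The Lie-group-based potential function P₁(g, g_d) = tr(K_R(I − R_dᵀR)) + (1/2)(p − p_d)ᵀ R_d K_p R_dᵀ (p − p_d) on SE(3) is left invariant: for every g_l = (R_l, p_l) ∈ SE(3) and all g = (R, p), g_d = (R_d, p_d) ∈ SE(3), P₁(g_l g, g_l g_d) = P₁(g, g_d), where g_l g and g_l g_d denote products of the corresponding homogeneous matrices. -/
open Matrix

noncomputable section

/-- Hat map: `hat x` is the 3×3 skew-symmetric matrix with `(hat x) *ᵥ y = x ×₃ y`. -/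
def hat (x : Fin 3 → ℝ) : Matrix (Fin 3) (Fin 3) ℝ :=
  !![0, -x 2, x 1; x 2, 0, -x 0; -x 1, x 0, 0]

/-- Vee map: the inverse of the hat map on skew-symmetric matrices. -/
def vee (S : Matrix (Fin 3) (Fin 3) ℝ) : Fin 3 → ℝ :=
  ![S 2 1, S 0 2, S 1 0]

/-- Euclidean norm on ℝ³. -/
def enorm3 (x : Fin 3 → ℝ) : ℝ := Real.sqrt (x ⬝ᵥ x)

/-- `R ∈ SO(3)`: `RᵀR = I` and `det R = 1`. -/
def SO3 (R : Matrix (Fin 3) (Fin 3) ℝ) : Prop := Rᵀ * R = 1 ∧ R.det = 1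

/-- Squared Frobenius norm: `‖A‖_F² = tr(AᵀA)`. -/
def frobSq {n : Type*} [Fintype n] (A : Matrix n n ℝ) : ℝ := (Aᵀ * A).trace

/-- The 4×4 homogeneous matrix `[[R, p],[0, 1]]` of `(R, p) ∈ SE(3)`. -/
def homog (R : Matrix (Fin 3) (Fin 3) ℝ) (p : Fin 3 → ℝ) :
    Matrix (Fin 3 ⊕ Fin 1) (Fin 3 ⊕ Fin 1) ℝ :=
  Matrix.fromBlocks R (Matrix.of fun i _ => p i) 0 1

/-- se(3) element `ξ̂ = [[ω̂, v],[0, 0]]` for `ξ = (v, ω)`. -/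
def xihat (v ω : Fin 3 → ℝ) : Matrix (Fin 3 ⊕ Fin 1) (Fin 3 ⊕ Fin 1) ℝ :=
  Matrix.fromBlocks (hat ω) (Matrix.of fun i _ => v i) 0 0

/-- The matrix `A(ψ) = I + ((1-cos θ)/θ)(ψ̂/θ) + (1 - sin θ/θ)(ψ̂²/θ²)`, `θ = ‖ψ‖`. -/
def Amat (ψ : Fin 3 → ℝ) : Matrix (Fin 3) (Fin 3) ℝ :=
  1 + ((1 - Real.cos (enorm3 ψ)) / (enorm3 ψ) ^ 2) • hat ψ
    + ((1 - Real.sin (enorm3 ψ) / enorm3 ψ) / (enorm3 ψ) ^ 2) • (hat ψ) ^ 2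

/-- The 6×6 Adjoint matrix `Ad_g = [[R, p̂R],[0, R]]`, acting on `ξ = (v, ω)`. -/
def Ad6 (R : Matrix (Fin 3) (Fin 3) ℝ) (p : Fin 3 → ℝ) :
    Matrix (Fin 3 ⊕ Fin 3) (Fin 3 ⊕ Fin 3) ℝ :=
  Matrix.fromBlocks R (hat p * R) 0 R

/-- The Lie-group-based potential function `P₁(g, g_d)` on SE(3). -/
def P1 (Kp KR : Matrix (Fin 3) (Fin 3) ℝ) (R : Matrix (Fin 3) (Fin 3) ℝ) (p : Fin 3 → ℝ)
    (Rd : Matrix (Fin 3) (Fin 3) ℝ) (pd : Fin 3 → ℝ) : ℝ :=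
  (KR * (1 - Rdᵀ * R)).trace + (1 / 2) * ((p - pd) ⬝ᵥ (Rd * Kp * Rdᵀ) *ᵥ (p - pd))

/-- `P₁` is left invariant: `P₁(g_l g, g_l g_d) = P₁(g, g_d)` for every
rigid transformation `g_l = (R_l, p_l)`, where `g_l g = (R_l R, R_l p + p_l)` is the
product of the corresponding homogeneous matrices. -/
theorem P1_left_invariant (Kp KR : Matrix (Fin 3) (Fin 3) ℝ)
    (hKp : Kp.IsSymm) (hKR : KR.IsSymm)
    (Rl R Rd : Matrix (Fin 3) (Fin 3) ℝ) (pl p pd : Fin 3 → ℝ)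
    (hRl : SO3 Rl) (hR : SO3 R) (hRd : SO3 Rd) :
    P1 Kp KR (Rl * R) (Rl *ᵥ p + pl) (Rl * Rd) (Rl *ᵥ pd + pl) = P1 Kp KR R p Rd pd := by
  have hdiff : Rl *ᵥ p + pl - (Rl *ᵥ pd + pl) = Rl *ᵥ (p - pd) := by
    rw [mulVec_sub, add_sub_add_right_eq_sub]
  have hrot : (Rl * Rd)ᵀ * (Rl * R) = Rdᵀ * R := by
    rw [transpose_mul, Matrix.mul_assoc, ← Matrix.mul_assoc Rlᵀ, hRl.1, Matrix.one_mul]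
  have hstiff : Rlᵀ * (Rl * Rd * Kp * (Rl * Rd)ᵀ * Rl) = Rd * Kp * Rdᵀ := by
    calc Rlᵀ * (Rl * Rd * Kp * (Rl * Rd)ᵀ * Rl)
        = (Rlᵀ * Rl) * (Rd * Kp * Rdᵀ) * (Rlᵀ * Rl) := by
          simp only [transpose_mul, Matrix.mul_assoc]
      _ = Rd * Kp * Rdᵀ := by rw [hRl.1, Matrix.one_mul, Matrix.mul_one]
  unfold P1
  rw [hdiff, hrot, mulVec_mulVec, ← vecMul_transpose, ← dotProduct_mulVec, mulVec_mulVec, hstiff]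
end
end

section
/- If K_p and K_R are symmetric positive definite 3×3 real matrices, then the Lie-group-based potential function P₁(g, g_d) = tr(K_R(I − R_dᵀR)) + (1/2)(p − p_d)ᵀ R_d K_p R_dᵀ (p − p_d) is positive definite on SE(3): P₁(g, g_d) ≥ 0 for all g = (R, p), g_d = (R_d, p_d) ∈ SE(3), with equality if and only if R = R_d and p = p_d. -/
open Matrix

noncomputable section

theorem trace_mul_mul_transpose_eq_sum {m n : Type*} [Fintype m] [Fintype n]
    (A : Matrix m n ℝ) (K : Matrix n n ℝ) :
    (A * K * Aᵀ).trace = ∑ i, A i ⬝ᵥ K *ᵥ A i := by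
  refine Finset.sum_congr rfl fun i _ => ?_
  rw [dotProduct_mulVec]
  rfl

theorem two_mul_trace_mul_one_sub {n : Type*} [Fintype n] [DecidableEq n]
    {K Q : Matrix n n ℝ} (hK : K.IsSymm) (hQ : Qᵀ * Q = 1) :
    2 * (K * (1 - Q)).trace = ((1 - Q) * K * (1 - Q)ᵀ).trace := by
  have hKQ : (K * Qᵀ).trace = (K * Q).trace := by
    rw [← trace_transpose, transpose_mul, transpose_transpose, hK.eq, trace_mul_comm]
  have hgram : (1 - Q)ᵀ * (1 - Q) = 1 + 1 - Q - Qᵀ := by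
    rw [transpose_sub, transpose_one, sub_mul, mul_sub, mul_sub, hQ]
    simp only [one_mul, mul_one]
    abel
  rw [trace_mul_cycle, hgram, trace_mul_comm _ K]
  simp only [mul_sub, mul_add, mul_one, trace_sub, trace_add, hKQ]
  ring

theorem dotProduct_mulVec_nonneg_of_pos {n : Type*} [Fintype n] {K : Matrix n n ℝ}
    (hK : ∀ x : n → ℝ, x ≠ 0 → 0 < x ⬝ᵥ K *ᵥ x) (x : n → ℝ) : 0 ≤ x ⬝ᵥ K *ᵥ x := by
  rcases eq_or_ne x 0 with rfl | hx
  · simp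
  · exact (hK x hx).le

theorem dotProduct_mulVec_eq_zero_iff_of_pos {n : Type*} [Fintype n] {K : Matrix n n ℝ}
    (hK : ∀ x : n → ℝ, x ≠ 0 → 0 < x ⬝ᵥ K *ᵥ x) (x : n → ℝ) :
    x ⬝ᵥ K *ᵥ x = 0 ↔ x = 0 := by
  refine ⟨fun h => ?_, fun h => by simp [h]⟩
  by_contra hx
  exact (hK x hx).ne' h

theorem trace_mul_mul_transpose_nonneg {m n : Type*} [Fintype m] [Fintype n]
    {K : Matrix n n ℝ} (hK : ∀ x : n → ℝ, x ≠ 0 → 0 < x ⬝ᵥ K *ᵥ x) (A : Matrix m n ℝ) :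
    0 ≤ (A * K * Aᵀ).trace := by
  rw [trace_mul_mul_transpose_eq_sum]
  exact Finset.sum_nonneg fun i _ => dotProduct_mulVec_nonneg_of_pos hK (A i)

theorem trace_mul_mul_transpose_eq_zero_iff {m n : Type*} [Fintype m] [Fintype n]
    {K : Matrix n n ℝ} (hK : ∀ x : n → ℝ, x ≠ 0 → 0 < x ⬝ᵥ K *ᵥ x) (A : Matrix m n ℝ) :
    (A * K * Aᵀ).trace = 0 ↔ A = 0 := by
  rw [trace_mul_mul_transpose_eq_sum,
    Finset.sum_eq_zero_iff_of_nonneg fun i _ => dotProduct_mulVec_nonneg_of_pos hK (A i)]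
  simp only [Finset.mem_univ, true_imp_iff, dotProduct_mulVec_eq_zero_iff_of_pos hK]
  exact funext_iff.symm

/-- if `K_p, K_R` are symmetric positive definite, then `P₁ ≥ 0` with
equality iff `R = R_d` and `p = p_d`. -/
theorem P1_positive_definite (Kp KR : Matrix (Fin 3) (Fin 3) ℝ)
    (hKp : Kp.IsSymm) (hKR : KR.IsSymm)
    (hKppos : ∀ x : Fin 3 → ℝ, x ≠ 0 → 0 < x ⬝ᵥ Kp *ᵥ x)
    (hKRpos : ∀ x : Fin 3 → ℝ, x ≠ 0 → 0 < x ⬝ᵥ KR *ᵥ x)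
    (R Rd : Matrix (Fin 3) (Fin 3) ℝ) (p pd : Fin 3 → ℝ)
    (hR : SO3 R) (hRd : SO3 Rd) :
    0 ≤ P1 Kp KR R p Rd pd ∧ (P1 Kp KR R p Rd pd = 0 ↔ R = Rd ∧ p = pd) := by
  have hRdRdT : Rd * Rdᵀ = 1 := mul_eq_one_comm.mp hRd.1
  have hQ : (Rdᵀ * R)ᵀ * (Rdᵀ * R) = 1 := by
    rw [transpose_mul, transpose_transpose, Matrix.mul_assoc, ← Matrix.mul_assoc Rd, hRdRdT,
      Matrix.one_mul, hR.1]
  have htrace := two_mul_trace_mul_one_sub hKR hQ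
  have hrot := trace_mul_mul_transpose_nonneg hKRpos (1 - Rdᵀ * R)
  have hquad : (p - pd) ⬝ᵥ (Rd * Kp * Rdᵀ) *ᵥ (p - pd) =
      (Rdᵀ *ᵥ (p - pd)) ⬝ᵥ Kp *ᵥ (Rdᵀ *ᵥ (p - pd)) := by
    rw [← mulVec_mulVec, ← mulVec_mulVec, dotProduct_mulVec, ← mulVec_transpose]
  have hpos := dotProduct_mulVec_nonneg_of_pos hKppos (Rdᵀ *ᵥ (p - pd))
  have hP : P1 Kp KR R p Rd pd = (1 / 2) * (((1 - Rdᵀ * R) * KR * (1 - Rdᵀ * R)ᵀ).trace +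
      (Rdᵀ *ᵥ (p - pd)) ⬝ᵥ Kp *ᵥ (Rdᵀ *ᵥ (p - pd))) := by
    rw [P1, hquad]
    linarith
  have hRiff : 1 - Rdᵀ * R = 0 ↔ R = Rd := by
    refine ⟨fun h => ?_, fun h => by rw [h, hRd.1, sub_self]⟩
    rw [← Matrix.one_mul R, ← hRdRdT, Matrix.mul_assoc, ← sub_eq_zero.mp h, Matrix.mul_one]
  have hpiff : Rdᵀ *ᵥ (p - pd) = 0 ↔ p = pd := by
    refine ⟨fun h => sub_eq_zero.mp ?_, fun h => by rw [h, sub_self, mulVec_zero]⟩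
    rw [← one_mulVec (p - pd), ← hRdRdT, ← mulVec_mulVec, h, mulVec_zero]
  rw [hP]
  refine ⟨by positivity, ?_⟩
  rw [mul_eq_zero_iff_left (by norm_num), add_eq_zero_iff_of_nonneg hrot hpos,
    trace_mul_mul_transpose_eq_zero_iff hKRpos, dotProduct_mulVec_eq_zero_iff_of_pos hKppos,
    hRiff, hpiff]
end
end

section
/- Inverse formula for A(ψ): for every ψ ∈ ℝ³ with 0 < ‖ψ‖ < 2π, letting θ = ‖ψ‖ and α(y) = (y/2)·cot(y/2), the matrix B(ψ) = I − (1/2)ψ̂ + (1 − α(θ))·(ψ̂²/θ²) satisfies A(ψ)·B(ψ) = I and B(ψ)·A(ψ) = I, i.e., B(ψ) = A(ψ)⁻¹. -/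
open Matrix

noncomputable section

theorem enorm3_sq (x : Fin 3 → ℝ) : enorm3 x ^ 2 = x ⬝ᵥ x :=
  Real.sq_sqrt (Finset.sum_nonneg fun i _ => mul_self_nonneg (x i))

theorem hat_pow_three (x : Fin 3 → ℝ) : hat x ^ 3 = -(enorm3 x ^ 2) • hat x := by
  rw [enorm3_sq]
  ext i j
  fin_cases i <;> fin_cases j <;>
    simp [hat, pow_succ, Matrix.mul_apply, Fin.sum_univ_three, dotProduct] <;> ring

/-- In an algebra, two quadratic polynomials in `X` with `X ^ 3 = -t • X` are inverse to each
other as soon as the reduced coefficients of `X` and `X ^ 2` in their product vanish. -/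
theorem quadratic_mul_quadratic_eq_one {R M : Type*} [CommRing R] [Ring M] [Algebra R M]
    {X : M} {t a b c d : R} (hX : X ^ 3 = -t • X)
    (h₁ : a + c - t * (a * d + b * c) = 0) (h₂ : b + d + a * c - t * (b * d) = 0) :
    (1 + a • X + b • X ^ 2) * (1 + c • X + d • X ^ 2) = 1 := by
  have hX4 : X ^ 4 = -t • X ^ 2 := by
    rw [pow_succ, hX, smul_mul_assoc, ← sq]
  have key : (1 + a • X + b • X ^ 2) * (1 + c • X + d • X ^ 2) =
      1 + (a + c) • X + (b + d + a * c) • X ^ 2 + (a * d + b * c) • X ^ 3 + (b * d) • X ^ 4 := by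
    simp only [add_mul, mul_add, one_mul, mul_one, smul_mul_assoc, mul_smul_comm,
      ← pow_succ, ← pow_succ', ← sq, ← pow_mul]
    module
  rw [key, hX, hX4]
  have : 1 + (a + c) • X + (b + d + a * c) • X ^ 2 + (a * d + b * c) • -t • X
      + (b * d) • -t • X ^ 2 = 1 + (a + c - t * (a * d + b * c)) • X
        + (b + d + a * c - t * (b * d)) • X ^ 2 := by
    module
  rw [this, h₁, h₂, zero_smul, zero_smul, add_zero, add_zero]

/-- inverse formula for `A(ψ)`: for `0 < ‖ψ‖ < 2π`, with `θ = ‖ψ‖` and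
`α(y) = (y/2)cot(y/2)`, the matrix `B(ψ) = I − (1/2)ψ̂ + (1 − α(θ))(ψ̂²/θ²)` satisfies
`A(ψ)B(ψ) = I` and `B(ψ)A(ψ) = I`. -/
theorem Amat_inverse_formula (ψ : Fin 3 → ℝ)
    (h0 : 0 < enorm3 ψ) (h2π : enorm3 ψ < 2 * Real.pi) :
    Amat ψ *
        (1 - (1 / 2 : ℝ) • hat ψ
          + ((1 - (enorm3 ψ / 2) * Real.cot (enorm3 ψ / 2)) / (enorm3 ψ) ^ 2) • (hat ψ) ^ 2)
      = 1 ∧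
    (1 - (1 / 2 : ℝ) • hat ψ
          + ((1 - (enorm3 ψ / 2) * Real.cot (enorm3 ψ / 2)) / (enorm3 ψ) ^ 2) • (hat ψ) ^ 2)
        * Amat ψ
      = 1 := by
  have hs : Real.sin (enorm3 ψ / 2) ≠ 0 :=
    (Real.sin_pos_of_pos_of_lt_pi (by linarith) (by linarith)).ne'
  have hX := hat_pow_three ψ
  have hB (e : ℝ) : 1 - (1 / 2 : ℝ) • hat ψ + e • hat ψ ^ 2 =
      1 + (-(1 / 2) : ℝ) • hat ψ + e • hat ψ ^ 2 := by
    module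
  rw [Amat, hB]
  generalize enorm3 ψ = θ at *
  have hθ : θ ≠ 0 := h0.ne'
  have hsin : Real.sin θ = 2 * Real.sin (θ / 2) * Real.cos (θ / 2) := by
    rw [← Real.sin_two_mul, mul_div_cancel₀ θ two_ne_zero]
  have hcos : Real.cos θ = 1 - 2 * Real.sin (θ / 2) ^ 2 := by
    have h := Real.cos_two_mul (θ / 2)
    rw [mul_div_cancel₀ θ two_ne_zero, Real.cos_sq'] at h
    linarith
  have hsc := Real.sin_sq_add_cos_sq (θ / 2)
  rw [hsin, hcos, Real.cot_eq_cos_div_sin]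
  generalize Real.sin (θ / 2) = s at *
  generalize Real.cos (θ / 2) = k at *
  constructor <;> refine quadratic_mul_quadratic_eq_one hX ?_ ?_ <;> field_simp <;> grind
end
end

section
/- Energy rate of the Lie-group potential along trajectories (Ṗ₁ = f_{G,1}ᵀ e_V): let R, R_d : ℝ → SO(3) and p, p_d : ℝ → ℝ³ be differentiable, with body velocities v, ω, v_d, ω_d : ℝ → ℝ³ satisfying Ṙ = R ω̂, ṗ = R v, Ṙ_d = R_d ω̂_d, ṗ_d = R_d v_d. Let K_p, K_R be constant symmetric 3×3 matrices and define P₁(t) = tr(K_R(I − R_dᵀR)) + (1/2)(p − p_d)ᵀ R_d K_p R_dᵀ (p − p_d), f_p = RᵀR_d K_p R_dᵀ(p − p_d), f_R = (K_R R_dᵀR − RᵀR_d K_R)∨, e_v = v − (RᵀR_d v_d + (Rᵀ(p_d − p))^ RᵀR_d ω_d), and e_ω = ω − RᵀR_d ω_d. Then for all t, dP₁/dt = f_pᵀ e_v + f_Rᵀ e_ω. -/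
open Matrix

noncomputable section

theorem hasDerivAt_mul_apply {l m n : Type*} [Fintype m] {A : ℝ → Matrix l m ℝ}
    {B : ℝ → Matrix m n ℝ} {A' : Matrix l m ℝ} {B' : Matrix m n ℝ} {t : ℝ}
    (hA : ∀ i j, HasDerivAt (fun s => A s i j) (A' i j) t)
    (hB : ∀ i j, HasDerivAt (fun s => B s i j) (B' i j) t) (i : l) (j : n) :
    HasDerivAt (fun s => (A s * B s) i j) ((A' * B t + A t * B') i j) t := by
  simp only [Matrix.add_apply, Matrix.mul_apply, ← Finset.sum_add_distrib]
  exact HasDerivAt.fun_sum fun k _ => (hA i k).mul (hB k j)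

theorem hasDerivAt_dotProduct {n : Type*} [Fintype n] {x y : ℝ → n → ℝ} {x' y' : n → ℝ} {t : ℝ}
    (hx : ∀ i, HasDerivAt (fun s => x s i) (x' i) t)
    (hy : ∀ i, HasDerivAt (fun s => y s i) (y' i) t) :
    HasDerivAt (fun s => x s ⬝ᵥ y s) (x' ⬝ᵥ y t + x t ⬝ᵥ y') t := by
  simp only [dotProduct, ← Finset.sum_add_distrib]
  exact HasDerivAt.fun_sum fun k _ => (hx k).mul (hy k)

theorem hasDerivAt_mulVec_apply {m n : Type*} [Fintype n] {A : ℝ → Matrix m n ℝ}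
    {x : ℝ → n → ℝ} {A' : Matrix m n ℝ} {x' : n → ℝ} {t : ℝ}
    (hA : ∀ i j, HasDerivAt (fun s => A s i j) (A' i j) t)
    (hx : ∀ i, HasDerivAt (fun s => x s i) (x' i) t) (i : m) :
    HasDerivAt (fun s => (A s *ᵥ x s) i) ((A' *ᵥ x t + A t *ᵥ x') i) t :=
  hasDerivAt_dotProduct (hA i) hx

theorem hasDerivAt_trace {n : Type*} [Fintype n] {A : ℝ → Matrix n n ℝ} {A' : Matrix n n ℝ}
    {t : ℝ} (hA : ∀ i j, HasDerivAt (fun s => A s i j) (A' i j) t) :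
    HasDerivAt (fun s => (A s).trace) A'.trace t :=
  HasDerivAt.fun_sum fun i _ => hA i i

theorem hat_transpose (x : Fin 3 → ℝ) : (hat x)ᵀ = -hat x := by
  ext i j
  fin_cases i <;> fin_cases j <;> simp [hat]

theorem hat_neg (x : Fin 3 → ℝ) : hat (-x) = -hat x := by
  ext i j
  fin_cases i <;> fin_cases j <;> simp [hat]

theorem hat_mulVec_swap (x y : Fin 3 → ℝ) : hat x *ᵥ y = -(hat y *ᵥ x) := by
  ext i
  fin_cases i <;> simp [hat, Matrix.mulVec, dotProduct, Fin.sum_univ_three] <;> ring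

theorem trace_mul_hat (A : Matrix (Fin 3) (Fin 3) ℝ) (w : Fin 3 → ℝ) :
    (A * hat w).trace = -(vee (A - Aᵀ) ⬝ᵥ w) := by
  simp [hat, vee, Matrix.trace, Matrix.mul_apply, dotProduct, Fin.sum_univ_three]
  ring

theorem transpose_mul_hat_mulVec_mul (Q : Matrix (Fin 3) (Fin 3) ℝ) (x : Fin 3 → ℝ) :
    Qᵀ * hat (Q *ᵥ x) * Q = Q.det • hat x := by
  ext i j
  fin_cases i <;> fin_cases j <;>
    simp [hat, Matrix.mul_apply, Matrix.mulVec, dotProduct, Fin.sum_univ_three,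
      Matrix.det_fin_three] <;> ring

theorem SO3.mul_transpose {Q : Matrix (Fin 3) (Fin 3) ℝ} (hQ : SO3 Q) : Q * Qᵀ = 1 :=
  mul_eq_one_comm.mp hQ.1

theorem SO3.transpose {Q : Matrix (Fin 3) (Fin 3) ℝ} (hQ : SO3 Q) : SO3 Qᵀ :=
  ⟨by rw [transpose_transpose, hQ.mul_transpose], by rw [det_transpose, hQ.2]⟩

theorem SO3.mul {P Q : Matrix (Fin 3) (Fin 3) ℝ} (hP : SO3 P) (hQ : SO3 Q) : SO3 (P * Q) :=
  ⟨by rw [transpose_mul, Matrix.mul_assoc, ← Matrix.mul_assoc Pᵀ, hP.1, Matrix.one_mul, hQ.1],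
    by rw [det_mul, hP.2, hQ.2, one_mul]⟩

theorem SO3.hat_mulVec {Q : Matrix (Fin 3) (Fin 3) ℝ} (hQ : SO3 Q) (x : Fin 3 → ℝ) :
    hat (Q *ᵥ x) = Q * hat x * Qᵀ := by
  have h := transpose_mul_hat_mulVec_mul Q x
  rw [hQ.2, one_smul] at h
  rw [← h]
  simp only [← Matrix.mul_assoc, hQ.mul_transpose, Matrix.one_mul]
  rw [Matrix.mul_assoc, hQ.mul_transpose, Matrix.mul_one]

/-- Rate of the rotational potential, written with the relative rotation `Q = R_dᵀR`. -/
theorem neg_trace_mul_relative_rate {K Q : Matrix (Fin 3) (Fin 3) ℝ} (hK : K.IsSymm)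
    (hQ : SO3 Q) (w wd : Fin 3 → ℝ) :
    -(K * (Q * hat w - hat wd * Q)).trace = vee (K * Q - Qᵀ * K) ⬝ᵥ (w - Qᵀ *ᵥ wd) := by
  have h : K * (Q * hat w - hat wd * Q) = K * Q * hat (w - Qᵀ *ᵥ wd) := by
    have hs : hat (w - Qᵀ *ᵥ wd) = hat w - hat (Qᵀ *ᵥ wd) := by
      ext i j
      fin_cases i <;> fin_cases j <;> simp [hat] <;> ring
    rw [hs, hQ.transpose.hat_mulVec, transpose_transpose, Matrix.mul_assoc, Matrix.mul_sub Q]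
    simp only [← Matrix.mul_assoc Q, hQ.mul_transpose, Matrix.one_mul]
  rw [h, trace_mul_hat, neg_neg, transpose_mul, hK.eq]

/-- Rate of the translational potential, written with the relative rotation `Q = R_dᵀR` and the
position error `y` in the desired frame. -/
theorem mulVec_dotProduct_relative_rate {Q : Matrix (Fin 3) (Fin 3) ℝ} (hQ : SO3 Q)
    (k y v vd wd : Fin 3 → ℝ) :
    (Qᵀ *ᵥ k) ⬝ᵥ (v - (Qᵀ *ᵥ vd + hat (-(Qᵀ *ᵥ y)) *ᵥ (Qᵀ *ᵥ wd))) =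
      k ⬝ᵥ (Q *ᵥ v - vd - hat wd *ᵥ y) := by
  have hcross : hat (Qᵀ *ᵥ y) *ᵥ (Qᵀ *ᵥ wd) = Qᵀ *ᵥ (hat y *ᵥ wd) := by
    rw [hQ.transpose.hat_mulVec, transpose_transpose, mulVec_mulVec, Matrix.mul_assoc,
      hQ.mul_transpose, Matrix.mul_one, mulVec_mulVec]
  rw [mulVec_transpose, ← dotProduct_mulVec, hat_neg, neg_mulVec, hcross, hat_mulVec_swap wd y,
    ← mulVec_neg, ← mulVec_add, mulVec_sub, mulVec_mulVec, hQ.mul_transpose, one_mulVec]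
  congr 1
  abel

/-- energy rate of the Lie-group potential, `Ṗ₁ = f_{G,1}ᵀ e_V`:
along trajectories with body velocities `Ṙ = Rω̂`, `ṗ = Rv`, `Ṙ_d = R_dω̂_d`,
`ṗ_d = R_dv_d`, the potential
`P₁ = tr(K_R(I − R_dᵀR)) + (1/2)(p − p_d)ᵀR_dK_pR_dᵀ(p − p_d)` satisfies
`dP₁/dt = f_pᵀe_v + f_Rᵀe_ω`. -/
theorem P1_energy_rate
    (R Rd : ℝ → Matrix (Fin 3) (Fin 3) ℝ) (p pd v ω vd ωd : ℝ → Fin 3 → ℝ)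
    (Kp KR : Matrix (Fin 3) (Fin 3) ℝ) (hKp : Kp.IsSymm) (hKR : KR.IsSymm)
    (hRso : ∀ t, SO3 (R t)) (hRdso : ∀ t, SO3 (Rd t))
    (hR : ∀ t i j, HasDerivAt (fun s => R s i j) ((R t * hat (ω t)) i j) t)
    (hp : ∀ t i, HasDerivAt (fun s => p s i) ((R t *ᵥ v t) i) t)
    (hRd : ∀ t i j, HasDerivAt (fun s => Rd s i j) ((Rd t * hat (ωd t)) i j) t)
    (hpd : ∀ t i, HasDerivAt (fun s => pd s i) ((Rd t *ᵥ vd t) i) t) (t : ℝ) :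
    HasDerivAt
      (fun s => (KR * (1 - (Rd s)ᵀ * R s)).trace
        + (1 / 2) * ((p s - pd s) ⬝ᵥ (Rd s * Kp * (Rd s)ᵀ) *ᵥ (p s - pd s)))
      ((((R t)ᵀ * Rd t * Kp * (Rd t)ᵀ) *ᵥ (p t - pd t))
          ⬝ᵥ (v t - (((R t)ᵀ * Rd t) *ᵥ vd t
              + hat ((R t)ᵀ *ᵥ (pd t - p t)) *ᵥ (((R t)ᵀ * Rd t) *ᵥ ωd t)))
        + vee (KR * (Rd t)ᵀ * R t - (R t)ᵀ * Rd t * KR)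
          ⬝ᵥ (ω t - ((R t)ᵀ * Rd t) *ᵥ ωd t)) t := by
  set Q : ℝ → Matrix (Fin 3) (Fin 3) ℝ := fun s => (Rd s)ᵀ * R s with hQdef
  set y : ℝ → Fin 3 → ℝ := fun s => (Rd s)ᵀ *ᵥ (p s - pd s) with hydef
  have hQ : SO3 (Q t) := (hRdso t).transpose.mul (hRso t)
  have hRdT : ∀ i j, HasDerivAt (fun s => (Rd s)ᵀ i j) ((-(hat (ωd t) * (Rd t)ᵀ)) i j) t := by
    intro i j
    have h := hRd t j i
    rwa [← transpose_apply (Rd t * _), transpose_mul, hat_transpose, Matrix.neg_mul] at h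
  have hQ' : ∀ i j, HasDerivAt (fun s => Q s i j)
      ((Q t * hat (ω t) - hat (ωd t) * Q t) i j) t := by
    intro i j
    convert hasDerivAt_mul_apply hRdT (hR t) i j using 1
    refine congrFun (congrFun ?_ i) j
    simp only [hQdef, Matrix.neg_mul, Matrix.mul_assoc]
    abel
  have hy' : ∀ i, HasDerivAt (fun s => y s i)
      ((Q t *ᵥ v t - vd t - hat (ωd t) *ᵥ y t) i) t := by
    intro i
    have hd : ∀ i, HasDerivAt (fun s => (p s - pd s) i) ((R t *ᵥ v t - Rd t *ᵥ vd t) i) t :=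
      fun i => (hp t i).sub (hpd t i)
    convert hasDerivAt_mulVec_apply hRdT hd i using 1
    refine congrFun ?_ i
    simp only [hQdef, hydef, mulVec_sub, neg_mulVec, mulVec_mulVec, (hRdso t).1, one_mulVec]
    abel
  have hrot := (hasDerivAt_trace (hasDerivAt_mul_apply (A := fun _ => KR) (A' := 0)
    (fun _ _ => hasDerivAt_const t _) hQ')).const_sub KR.trace
  have htrans := (hasDerivAt_dotProduct hy' (hasDerivAt_mulVec_apply (A := fun _ => Kp) (A' := 0)
    (fun _ _ => hasDerivAt_const t _) hy')).const_mul (1 / 2)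
  refine ((hrot.add htrans).congr_deriv ?_).congr_of_eventuallyEq (.of_forall fun s => ?_)
  · have hQT : (R t)ᵀ * Rd t = (Q t)ᵀ := by simp [hQdef]
    have hfp : ((R t)ᵀ * Rd t * Kp * (Rd t)ᵀ) *ᵥ (p t - pd t) = (Q t)ᵀ *ᵥ (Kp *ᵥ y t) := by
      simp only [hQT, hydef, mulVec_mulVec, Matrix.mul_assoc]
    have hpos : (R t)ᵀ *ᵥ (pd t - p t) = -((Q t)ᵀ *ᵥ y t) := by
      rw [← hQT, hydef, mulVec_mulVec, Matrix.mul_assoc, (hRdso t).mul_transpose, Matrix.mul_one,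
        ← mulVec_neg, neg_sub]
    have hsymm : ∀ x, y t ⬝ᵥ Kp *ᵥ x = x ⬝ᵥ Kp *ᵥ y t := fun x => by
      rw [dotProduct_mulVec, ← mulVec_transpose, hKp.eq, dotProduct_comm]
    rw [hfp, hpos, hQT, Matrix.mul_assoc KR, mulVec_dotProduct_relative_rate hQ,
      ← neg_trace_mul_relative_rate hKR hQ, Matrix.zero_mul, zero_add, zero_mulVec, zero_add,
      hsymm, dotProduct_comm (Kp *ᵥ y t)]
    ring
  · simp only [hQdef, hydef, Pi.add_apply, Matrix.mul_sub, Matrix.mul_one, trace_sub]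
    congr 2
    rw [mulVec_transpose, ← dotProduct_mulVec]
    simp only [← mulVec_transpose, mulVec_mulVec, Matrix.mul_assoc]
end
end
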